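/- If an annotated partial order P = (X1, X2, P, val, S, GoodW) is minimal and K is the closure of P, then K is also minimal. -/

import Mathlib

/-!
Statement 1: If an annotated partial order `P = (X1, X2, P, val, S, GoodW)` is minimal
and `K` is the closure of `P`, then `K` is also minimal.
-/

/-- An annotated partial order: a set of events split into root-thread events `X1`
and leaf-thread events `X2`, a (strict) partial order `lt` over the events, a value
function `val`, a side function `S`, and a good-writes function `GoodW`. -/
structure APO (Event Value Side : Type) where
  X1 : Set Event
  X2 : Set Event
  lt : Event → Event → Prop
  lt_irrefl : ∀ e, ¬ lt e e
  lt_trans : ∀ a b c, lt a b → lt b c → lt a c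
  val : Event → Value
  S : Event → Side
  GoodW : Event → Set Event

namespace APO

variable {Event Value Side : Type}

/-- The set of events `X = X1 ∪ X2` of an annotated partial order. -/
def events (P : APO Event Value Side) : Set Event := P.X1 ∪ P.X2

/-- `Q` has the same event sets and annotations (`val`, `S`, `GoodW`) as `P`. -/
def SameAnn (Q P : APO Event Value Side) : Prop :=
  Q.X1 = P.X1 ∧ Q.X2 = P.X2 ∧ Q.val = P.val ∧ Q.S = P.S ∧ Q.GoodW = P.GoodW

/-- `Q ⊑ P`: the partial order of `Q` refines (strengthens) that of `P`. -/
def Refines (Q P : APO Event Value Side) : Prop :=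
  ∀ e1 e2, P.lt e1 e2 → Q.lt e1 e2

/-- `Q ≼ P`: `Q` leaf-refines `P`, i.e. `Q` agrees with `P` on the order of every pair
of conflicting events of `X` belonging to leaf threads (the events in `X2`). -/
def LeafRefines (Confl : Event → Event → Prop) (Q P : APO Event Value Side) : Prop :=
  ∀ e1 e2, e1 ∈ P.events → e2 ∈ P.events → e1 ∈ P.X2 → e2 ∈ P.X2 →
    Confl e1 e2 → P.lt e1 e2 → Q.lt e1 e2

/-- `P` is minimal (w.r.t. an abstract closedness predicate `Closed`): every closed
annotated partial order `Q` with the same event sets and annotations that leaf-refines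
`P` also refines `P`. -/
def Minimal (Confl : Event → Event → Prop)
    (Closed : APO Event Value Side → Prop) (P : APO Event Value Side) : Prop :=
  ∀ Q, SameAnn Q P → Closed Q → LeafRefines Confl Q P → Refines Q P

/-- `K` is the closure of `P`: the weakest strengthening of `P` into a closed annotated
partial order (with the same event sets and annotations). -/
def IsClosure (Closed : APO Event Value Side → Prop)
    (P K : APO Event Value Side) : Prop :=
  SameAnn K P ∧ Closed K ∧ Refines K P ∧
    ∀ Q, SameAnn Q P → Closed Q → Refines Q P → Refines Q K

end APO

/-- If `P` is minimal and `K` is the closure of `P`, then `K` is also minimal. -/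
theorem closure_of_minimal_is_minimal {Event Value Side : Type}
    (Confl : Event → Event → Prop) (Closed : APO Event Value Side → Prop)
    (P K : APO Event Value Side)
    (hmin : APO.Minimal Confl Closed P)
    (hclos : APO.IsClosure Closed P K) :
    APO.Minimal Confl Closed K := by
  obtain ⟨hann, -, href, hweak⟩ := hclos
  intro Q hQK hQ hleaf
  obtain ⟨k1, k2, k3, k4, k5⟩ := hann
  obtain ⟨q1, q2, q3, q4, q5⟩ := hQK
  have hQP : APO.SameAnn Q P :=
    ⟨q1.trans k1, q2.trans k2, q3.trans k3, q4.trans k4, q5.trans k5⟩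
  refine hweak Q hQP hQ (hmin Q hQP hQ ?_)
  intro e1 e2 h1 h2 hx1 hx2 hc hlt
  have hev : K.events = P.events := by simp only [APO.events, k1, k2]
  exact hleaf e1 e2 (hev ▸ h1) (hev ▸ h2) (k2 ▸ hx1) (k2 ▸ hx2) hc (href e1 e2 hlt)
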